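/- (Blaschke–Lebesgue theorem.) Every convex body K in the Euclidean plane of constant width 1 satisfies volume(K) ≥ (π − √3)/2. -/

import Mathlib

open Metric Real MeasureTheory
open scoped InnerProductSpace Pointwise ENNReal

noncomputable section

/-- The Euclidean plane. -/
abbrev E2 := EuclideanSpace ℝ (Fin 2)

/-- The point of the Euclidean plane with the given coordinates. -/
def pt (a b : ℝ) : E2 := (EuclideanSpace.equiv (Fin 2) ℝ).symm ![a, b]

/-- The width of a set `C` in the direction of the unit vector `u`. -/
def dirWidth (C : Set E2) (u : E2) : ℝ :=
  sSup {w : ℝ | ∃ x ∈ C, ∃ y ∈ C, w = ⟪x - y, u⟫_ℝ}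

/-- The minimal width of a set: the infimum of the directional widths over all
unit vectors. -/
def minWidth (C : Set E2) : ℝ :=
  sInf {w : ℝ | ∃ u : E2, ‖u‖ = 1 ∧ w = dirWidth C u}

/-- The inradius of a set. -/
def inradius (C : Set E2) : ℝ :=
  sSup {r : ℝ | 0 ≤ r ∧ ∃ c : E2, closedBall c r ⊆ C}

/-- The circumradius of a set. -/
def circumradius (C : Set E2) : ℝ :=
  sInf {r : ℝ | 0 ≤ r ∧ ∃ c : E2, C ⊆ closedBall c r}

/-- The dual disk-polygon of a set `D`. -/
def dualDP (D : Set E2) : Set E2 := {y : E2 | ∀ x ∈ D, dist x y ≤ 1}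

/-- Closed one-dimensional slices: adding a vertical segment. -/
lemma bl_prod (D : Set (ℝ × ℝ)) (hD : IsCompact D) (hc : Convex ℝ D) (m w l : ℝ)
    (hl : 0 ≤ l)
    (hp : Prod.fst '' D = Set.Icc m (m + w)) :
    volume (D + (fun t : ℝ => ((0 : ℝ), t)) '' Set.Icc (-l) l) =
      volume D + ENNReal.ofReal (2 * l * w) := by
  have hS : IsCompact ((fun t : ℝ => ((0 : ℝ), t)) '' Set.Icc (-l) l) :=
    isCompact_Icc.image (by fun_prop)
  have h1 : MeasurableSet D := hD.isClosed.measurableSet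
  have h2 := (hD.add hS).isClosed.measurableSet
  rw [Measure.volume_eq_prod, Measure.prod_apply h1, Measure.prod_apply h2]
  have key : ∀ s : ℝ, volume (Prod.mk s ⁻¹' (D + (fun t : ℝ => ((0 : ℝ), t)) '' Set.Icc (-l) l))
      = volume (Prod.mk s ⁻¹' D) +
        (Set.Icc m (m + w)).indicator (fun _ => ENNReal.ofReal (2 * l)) s := by
    intro s
    by_cases hs : s ∈ Set.Icc m (m + w)
    · rw [Set.indicator_of_mem hs]
      have hne : (Prod.mk s ⁻¹' D).Nonempty := by
        rw [← hp] at hs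
        obtain ⟨⟨a, b⟩, hab, rfl⟩ := hs
        exact ⟨b, hab⟩
      have hcomp : IsCompact (Prod.mk s ⁻¹' D) := by
        have : Prod.mk s ⁻¹' D = Prod.snd '' (D ∩ Prod.fst ⁻¹' {s}) := by
          ext t
          constructor
          · intro ht
            exact ⟨(s, t), ⟨ht, rfl⟩, rfl⟩
          · rintro ⟨⟨a, b⟩, ⟨hab, h⟩, rfl⟩
            simp only [Set.mem_preimage, Set.mem_singleton_iff] at h
            subst h
            exact hab
        rw [this]
        exact (hD.inter_right (isClosed_singleton.preimage continuous_fst)).image continuous_snd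
      have hconv : Convex ℝ (Prod.mk s ⁻¹' D) := by
        intro a ha b hb p q hp hq hpq
        have := hc ha hb hp hq hpq
        simp only [Set.mem_preimage]
        convert this using 1
        ext
        · simp [← add_mul, hpq]
        · simp
      obtain ⟨a, b, hab⟩ : ∃ a b, Prod.mk s ⁻¹' D = Set.Icc a b :=
        ⟨_, _, eq_Icc_of_connected_compact ⟨hne, hconv.isPreconnected⟩ hcomp⟩
      have hle : a ≤ b := by
        rw [hab] at hne
        exact Set.nonempty_Icc.1 hne
      have hsum : Prod.mk s ⁻¹' (D + (fun t : ℝ => ((0 : ℝ), t)) '' Set.Icc (-l) l) =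
          Set.Icc (a - l) (b + l) := by
        ext t
        simp only [Set.mem_preimage, Set.mem_add, Set.mem_image, exists_exists_and_eq_and]
        constructor
        · rintro ⟨⟨x, y⟩, hxy, r, hr, h⟩
          simp only [Prod.mk_add_mk, add_zero, Prod.mk.injEq] at h
          obtain ⟨rfl, rfl⟩ := h
          have : y ∈ Set.Icc a b := by rw [← hab]; exact hxy
          simp only [Set.mem_Icc] at this hr ⊢
          constructor <;> linarith [this.1, this.2, hr.1, hr.2]
        · intro ht
          have hy : max a (t - l) ∈ Set.Icc a b :=
            ⟨le_max_left _ _, max_le hle (by linarith [ht.2])⟩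
          rw [← hab] at hy
          refine ⟨(s, max a (t - l)), hy, t - max a (t - l), ⟨?_, ?_⟩, by simp⟩
          · have : max a (t - l) ≤ t + l := max_le (by linarith [ht.1]) (by linarith)
            linarith
          · linarith [le_max_right a (t - l)]
      rw [hsum, hab, Real.volume_Icc, Real.volume_Icc, ← ENNReal.ofReal_add (by linarith)
        (by linarith)]
      congr 1
      ring
    · rw [Set.indicator_of_notMem hs]
      have e1 : Prod.mk s ⁻¹' D = ∅ := by
        ext t
        simp only [Set.mem_preimage, Set.mem_empty_iff_false, iff_false]
        intro h
        exact hs (hp ▸ ⟨_, h, rfl⟩)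
      have e2 : Prod.mk s ⁻¹' (D + (fun t : ℝ => ((0 : ℝ), t)) '' Set.Icc (-l) l) = ∅ := by
        ext t
        simp only [Set.mem_preimage, Set.mem_empty_iff_false, iff_false, Set.mem_add,
          Set.mem_image, exists_exists_and_eq_and]
        rintro ⟨⟨x, y⟩, hxy, r, hr, h⟩
        simp only [Prod.mk_add_mk, add_zero, Prod.mk.injEq] at h
        obtain ⟨rfl, rfl⟩ := h
        exact hs (hp ▸ ⟨_, hxy, rfl⟩)
      rw [e1, e2]
      simp
  simp_rw [key]
  rw [lintegral_add_right _ (measurable_const.indicator measurableSet_Icc),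
    lintegral_indicator measurableSet_Icc, lintegral_const, Measure.restrict_apply_univ,
    Real.volume_Icc, ← ENNReal.ofReal_mul (by linarith)]
  congr 3
  ring

lemma bl_inner (x : E2) (a b : ℝ) : ⟪x, pt a b⟫_ℝ = x 0 * a + x 1 * b := by
  simp [pt, PiLp.inner_apply, Fin.sum_univ_two]
  ring

/-- The unit vector at angle `θ`. -/
def uv (θ : ℝ) : E2 := pt (cos θ) (sin θ)

lemma uv_inner (x : E2) (θ : ℝ) : ⟪x, uv θ⟫_ℝ = x 0 * cos θ + x 1 * sin θ := bl_inner _ _ _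

@[simp] lemma uv_zero (θ : ℝ) : uv θ 0 = cos θ := by simp [uv, pt]
@[simp] lemma uv_one (θ : ℝ) : uv θ 1 = sin θ := by simp [uv, pt]

lemma uv_norm (θ : ℝ) : ‖uv θ‖ = 1 := by
  rw [EuclideanSpace.norm_eq]
  simp [Fin.sum_univ_two]

/-- rotation to coordinates -/
def rotL (θ : ℝ) : E2 →ₗᵢ[ℝ] E2 where
  toFun x := pt (x 0 * cos θ + x 1 * sin θ) (- x 0 * sin θ + x 1 * cos θ)
  map_add' x y := by
    ext i
    fin_cases i <;> simp [pt] <;> ring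
  map_smul' c x := by
    ext i
    fin_cases i <;> simp [pt] <;> ring
  norm_map' x := by
    rw [EuclideanSpace.norm_eq, EuclideanSpace.norm_eq]
    congr 1
    simp [Fin.sum_univ_two, pt]
    nlinarith [sin_sq_add_cos_sq θ]

/-- coordinates `(⟪x,u⟫, ⟪x,n⟫)` -/
def coo (θ : ℝ) (x : E2) : ℝ × ℝ := (x 0 * cos θ + x 1 * sin θ, - x 0 * sin θ + x 1 * cos θ)

lemma coo_mp (θ : ℝ) : MeasurePreserving (coo θ) := by
  have h1 := ((rotL θ).toLinearIsometryEquiv rfl).measurePreserving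
  have h2 := PiLp.volume_preserving_ofLp (Fin 2)
  have h3 := volume_preserving_finTwoArrow ℝ
  have := h3.comp (h2.comp h1)
  exact this

lemma coo_inj (θ : ℝ) : Function.Injective (coo θ) := by
  intro x y h
  simp only [coo, Prod.mk.injEq] at h
  obtain ⟨h1, h2⟩ := h
  have := sin_sq_add_cos_sq θ
  ext i
  fin_cases i
  · simp only [Fin.zero_eta]
    linear_combination cos θ * h1 - sin θ * h2 - (x 0 - y 0) * this
  · simp only [Fin.mk_one]
    linear_combination sin θ * h1 + cos θ * h2 - (x 1 - y 1) * this

/-- coordinates, linear version -/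
def cooL (θ : ℝ) : E2 →ₗ[ℝ] ℝ × ℝ where
  toFun := coo θ
  map_add' x y := by ext <;> simp [coo] <;> ring
  map_smul' c x := by ext <;> simp [coo] <;> ring

lemma coo_vol (θ : ℝ) (C : Set E2) (hC : IsCompact C) : volume (coo θ '' C) = volume C := by
  have hm := (hC.image (LinearMap.continuous_of_finiteDimensional (cooL θ))).isClosed.measurableSet
  have := (coo_mp θ).measure_preimage (s := coo θ '' C) hm.nullMeasurableSet
  rw [← this, Set.preimage_image_eq _ (coo_inj θ)]

/-- the segment orthogonal to `uv θ` with half length `l`. -/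
def seg (θ l : ℝ) : Set E2 := (fun t : ℝ => t • uv (θ + π / 2)) '' Set.Icc (-l) l

lemma seg_compact (θ l : ℝ) : IsCompact (seg θ l) := isCompact_Icc.image (by fun_prop)

lemma seg_convex (θ l : ℝ) : Convex ℝ (seg θ l) :=
  (convex_Icc (-l) l).is_linear_image (f := fun t : ℝ => t • uv (θ + π / 2))
    (IsLinearMap.isLinearMap_smul' _)

/-- `C` has projection of length `w` in direction `uv θ`. -/
def HasW (C : Set E2) (θ w : ℝ) : Prop := ∃ m, (fun x => ⟪x, uv θ⟫_ℝ) '' C = Set.Icc m (m + w)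

lemma HasW.add {C D : Set E2} {θ w v : ℝ} (hw : 0 ≤ w) (hv : 0 ≤ v)
    (h1 : HasW C θ w) (h2 : HasW D θ v) : HasW (C + D) θ (w + v) := by
  obtain ⟨m, hm⟩ := h1
  obtain ⟨n, hn⟩ := h2
  refine ⟨m + n, ?_⟩
  ext t
  constructor
  · rintro ⟨_, ⟨x, hx, y, hy, rfl⟩, rfl⟩
    have a1 : ⟪x, uv θ⟫_ℝ ∈ Set.Icc m (m + w) := hm ▸ ⟨x, hx, rfl⟩
    have a2 : ⟪y, uv θ⟫_ℝ ∈ Set.Icc n (n + v) := hn ▸ ⟨y, hy, rfl⟩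
    simp only [inner_add_left, Set.mem_Icc] at *
    constructor <;> linarith [a1.1, a1.2, a2.1, a2.2]
  · intro ht
    have a1 : max m (t - n - v) ∈ Set.Icc m (m + w) :=
      ⟨le_max_left _ _, max_le (by linarith) (by linarith [ht.2])⟩
    have a2 : t - max m (t - n - v) ∈ Set.Icc n (n + v) := by
      constructor
      · have : max m (t - n - v) ≤ t - n := max_le (by linarith [ht.1]) (by linarith)
        linarith
      · linarith [le_max_right m (t - n - v)]
    rw [← hm] at a1
    rw [← hn] at a2
    obtain ⟨x, hx, hx'⟩ := a1
    obtain ⟨y, hy, hy'⟩ := a2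
    refine ⟨x + y, ⟨x, hx, y, hy, rfl⟩, ?_⟩
    simp only [inner_add_left] at *
    rw [hx', hy']
    ring

lemma vol_seg (C : Set E2) (hC : IsCompact C) (hc : Convex ℝ C) (θ w l : ℝ)
    (hl : 0 ≤ l) (h : HasW C θ w) :
    volume (C + seg θ l) = volume C + ENNReal.ofReal (2 * l * w) := by
  obtain ⟨m, hm⟩ := h
  rw [← coo_vol θ C hC, ← coo_vol θ _ (hC.add (seg_compact θ l))]
  have h1 : coo θ '' (C + seg θ l) = coo θ '' C + (fun t : ℝ => ((0 : ℝ), t)) '' Set.Icc (-l) l := by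
    have := Set.image_add (cooL θ) (s := C) (t := seg θ l)
    change coo θ '' (C + seg θ l) = coo θ '' C + coo θ '' (seg θ l) at this
    rw [this]
    congr 1
    rw [seg, Set.image_image]
    refine Set.image_congr fun t _ => ?_
    have := sin_sq_add_cos_sq θ
    simp only [coo, PiLp.smul_apply, uv_zero, uv_one, cos_add_pi_div_two, sin_add_pi_div_two,
      smul_eq_mul, Prod.mk.injEq]
    constructor
    · ring
    · linear_combination t * this
  rw [h1]
  refine bl_prod _ (hC.image (LinearMap.continuous_of_finiteDimensional (cooL θ)))
    (hc.linear_image (cooL θ)) m w l hl ?_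
  rw [← hm, Set.image_image]
  refine Set.image_congr fun x _ => ?_
  rw [uv_inner]
  rfl

lemma HasW.seg (θ φ l c : ℝ) (hl : 0 ≤ l) (hc : |sin (φ - θ)| = c) :
    HasW (seg θ l) φ (2 * l * c) := by
  have hc0 : 0 ≤ c := hc ▸ abs_nonneg _
  have hi : ∀ t : ℝ, ⟪t • uv (θ + π / 2), uv φ⟫_ℝ = t * sin (φ - θ) := by
    intro t
    rw [inner_smul_left, uv_inner, sin_sub]
    simp [cos_add_pi_div_two, sin_add_pi_div_two]
    left; ring
  refine ⟨-(l * c), ?_⟩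
  rw [_root_.seg, Set.image_image]
  simp only [hi]
  rcases abs_choice (sin (φ - θ)) with h | h
  · have : sin (φ - θ) = c := by rw [← hc, h]
    rw [this, Set.image_mul_right_Icc (by linarith) hc0]
    congr 1 <;> ring
  · have : sin (φ - θ) = -c := by rw [← hc, h]; ring
    rw [this]
    have e : (fun t : ℝ => t * -c) = (fun t => t * c) ∘ (fun t => -t) := by
      ext t; simp
    rw [e, Set.image_comp, Set.image_neg_eq_neg, Set.neg_Icc, neg_neg,
      Set.image_mul_right_Icc (by linarith) hc0]
    congr 1 <;> ring

/-- half side length of the hexagon of width one -/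
def hl : ℝ := √3 / 6

lemma hl_nonneg : 0 ≤ hl := by unfold hl; positivity

/-- sum of `C` with centred hexagon -/
def hexSum (C : Set E2) (θ : ℝ) : Set E2 :=
  C + seg θ hl + seg (θ + π / 3) hl + seg (θ + 2 * π / 3) hl

lemma sin_two_pi_div_three' : sin (2 * π / 3) = √3 / 2 := by
  rw [show 2 * π / 3 = π - π / 3 by ring, sin_pi_sub, sin_pi_div_three]

lemma cos_two_pi_div_three' : cos (2 * π / 3) = -(1 / 2) := by
  rw [show 2 * π / 3 = π - π / 3 by ring, cos_pi_sub, cos_pi_div_three]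

lemma vol_hex (C : Set E2) (hC : IsCompact C) (hc : Convex ℝ C) (θ w : ℝ) (hw : 0 ≤ w)
    (h0 : HasW C θ w) (h1 : HasW C (θ + π / 3) w) (h2 : HasW C (θ + 2 * π / 3) w) :
    volume (hexSum C θ) = volume C + ENNReal.ofReal (√3 * w + √3 / 2) := by
  have s3 : √3 * √3 = 3 := Real.mul_self_sqrt (by norm_num)
  have hhl := hl_nonneg
  have e : 2 * hl * (√3 / 2) = 1 / 2 := by unfold hl; linear_combination (1 / 6) * s3
  have a01 : HasW (seg θ hl) (θ + π / 3) (1 / 2) := by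
    rw [← e]
    apply HasW.seg _ _ _ _ hhl
    rw [add_sub_cancel_left, sin_pi_div_three, abs_of_nonneg (by positivity)]
  have a02 : HasW (seg θ hl) (θ + 2 * π / 3) (1 / 2) := by
    rw [← e]
    apply HasW.seg _ _ _ _ hhl
    rw [add_sub_cancel_left, sin_two_pi_div_three', abs_of_nonneg (by positivity)]
  have a12 : HasW (seg (θ + π / 3) hl) (θ + 2 * π / 3) (1 / 2) := by
    rw [← e]
    apply HasW.seg _ _ _ _ hhl
    rw [show θ + 2 * π / 3 - (θ + π / 3) = π / 3 by ring, sin_pi_div_three,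
      abs_of_nonneg (by positivity)]
  have c1 := hC.add (seg_compact θ hl)
  have c2 := c1.add (seg_compact (θ + π / 3) hl)
  have d1 := hc.add (seg_convex θ hl)
  have d2 := d1.add (seg_convex (θ + π / 3) hl)
  rw [hexSum, vol_seg _ c2 d2 _ (w + 1 / 2 + 1 / 2) hl hhl
      ((h2.add hw (by norm_num) a02).add (by linarith) (by norm_num) a12),
    vol_seg _ c1 d1 _ (w + 1 / 2) hl hhl (h1.add hw (by norm_num) a01),
    vol_seg _ hC hc _ w hl hhl h0, add_assoc, add_assoc, ← ENNReal.ofReal_add (by positivity)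
      (by positivity), ← ENNReal.ofReal_add (by positivity) (by positivity)]
  congr 2
  unfold hl
  ring

/-- The hexagon given by strips is contained in the zonotope. -/
lemma mem_hex (c x : E2) (θ : ℝ)
    (h0 : |⟪x - c, uv θ⟫_ℝ| ≤ 1 / 2) (h1 : |⟪x - c, uv (θ + π / 3)⟫_ℝ| ≤ 1 / 2)
    (h2 : |⟪x - c, uv (θ + 2 * π / 3)⟫_ℝ| ≤ 1 / 2) : x ∈ hexSum {c} θ := by
  have s3 : √3 * √3 = 3 := Real.mul_self_sqrt (by norm_num)
  set s := ⟪x - c, uv θ⟫_ℝ with hs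
  set t := ⟪x - c, uv (θ + 2 * π / 3)⟫_ℝ with ht
  have hst : ⟪x - c, uv (θ + π / 3)⟫_ℝ = s + t := by
    rw [hs, ht]
    simp only [uv_inner, cos_add, sin_add, cos_pi_div_three, sin_pi_div_three,
      sin_two_pi_div_three', cos_two_pi_div_three']
    ring
  rw [hst] at h1
  rw [abs_le] at h0 h1 h2
  obtain ⟨r, hr1, hr2, hr3, hr4, hr5, hr6⟩ : ∃ r : ℝ, -(1/4) ≤ r ∧ r ≤ 1/4 ∧
      -(1/4) ≤ s - r ∧ s - r ≤ 1/4 ∧ -(1/4) ≤ t + r ∧ t + r ≤ 1/4 := by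
    refine ⟨max (-(1/4)) (max (s - 1/4) (-t - 1/4)), le_max_left _ _, ?_, ?_, ?_, ?_, ?_⟩
    · refine max_le ?_ (max_le ?_ ?_) <;> linarith
    · have : max (-(1/4)) (max (s - 1/4) (-t - 1/4)) ≤ s + 1/4 := by
        refine max_le ?_ (max_le ?_ ?_) <;> linarith
      linarith
    · have := le_trans (le_max_left (s - 1/4) (-t - 1/4)) (le_max_right (-(1/4)) _)
      linarith
    · have := le_trans (le_max_right (s - 1/4) (-t - 1/4)) (le_max_right (-(1/4)) _)
      linarith
    · have : max (-(1/4)) (max (s - 1/4) (-t - 1/4)) ≤ -t + 1/4 := by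
        refine max_le ?_ (max_le ?_ ?_) <;> linarith
      linarith
  have s0 : 0 < √3 := by positivity
  have mem : ∀ q : ℝ, -(1/4) ≤ q → q ≤ 1/4 → 2 * √3 / 3 * q ∈ Set.Icc (-hl) hl := by
    intro q h1 h2
    unfold hl
    constructor <;> nlinarith
  -- coefficients
  refine ⟨c + (2 * √3 / 3 * (t + r)) • uv (θ + π / 2)
      + (2 * √3 / 3 * (-r)) • uv (θ + π / 3 + π / 2), ⟨c + (2 * √3 / 3 * (t + r)) • uv (θ + π / 2),
      ⟨c, rfl, _, ⟨_, mem _ hr5 hr6, rfl⟩, rfl⟩, _, ⟨_, mem _ (by linarith) (by linarith), rfl⟩, rfl⟩,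
      _, ⟨2 * √3 / 3 * (-(s - r)), mem _ (by linarith) (by linarith), rfl⟩, ?_⟩
  have cs := sin_sq_add_cos_sq θ
  clear_value s t
  simp only [uv_inner] at hs ht
  simp only [cos_add, sin_add, sin_two_pi_div_three', cos_two_pi_div_three', PiLp.sub_apply] at hs ht
  obtain ⟨n, hn⟩ : ∃ n : ℝ, n = -(x 0 - c 0) * sin θ + (x 1 - c 1) * cos θ := ⟨_, rfl⟩
  have ht' : t + s / 2 = √3 / 2 * n := by rw [ht, hs, hn]; ring
  have hX : x 0 - c 0 = s * cos θ - n * sin θ := by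
    rw [hs, hn]; linear_combination -(x 0 - c 0) * cs
  have hY : x 1 - c 1 = s * sin θ + n * cos θ := by
    rw [hs, hn]; linear_combination -(x 1 - c 1) * cs
  ext i
  fin_cases i
  · simp [cos_add_pi_div_two]
    simp only [sin_add, sin_two_pi_div_three', cos_two_pi_div_three', cos_pi_div_three,
      sin_pi_div_three]
    linear_combination -hX + cos θ * s / 3 * s3 - 2 * √3 / 3 * sin θ * ht' - sin θ * n / 3 * s3
  · simp [sin_add_pi_div_two]
    simp only [cos_add, sin_two_pi_div_three', cos_two_pi_div_three', cos_pi_div_three,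
      sin_pi_div_three]
    linear_combination -hY + sin θ * s / 3 * s3 + 2 * √3 / 3 * cos θ * ht' + cos θ * n / 3 * s3

lemma lip_vol (A : Set E2) (T : E2 → E2)
    (h : ∀ x ∈ A, ∀ y ∈ A, dist x y ≤ dist (T x) (T y)) : volume A ≤ volume (T '' A) := by
  have hinj : Set.InjOn T A := by
    intro x hx y hy hxy
    have := h x hx y hy
    rw [hxy, dist_self] at this
    exact dist_le_zero.1 this
  have hl : LipschitzOnWith 1 (Function.invFunOn T A) (T '' A) := by
    apply LipschitzOnWith.of_dist_le_mul
    rintro _ ⟨x, hx, rfl⟩ _ ⟨y, hy, rfl⟩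
    rw [hinj.leftInvOn_invFunOn hx, hinj.leftInvOn_invFunOn hy]
    simpa using h x hx y hy
  have him : Function.invFunOn T A '' (T '' A) = A := hinj.leftInvOn_invFunOn.image_image
  have h1 := hl.hausdorffMeasure_image_le (d := (Module.finrank ℝ E2 : ℝ)) (by positivity)
  rw [him] at h1
  rw [Measure.isAddLeftInvariant_eq_smul (volume : Measure E2) μH[(Module.finrank ℝ E2 : ℝ)]]
  simp only [Measure.smul_apply]
  have h2 : μH[(Module.finrank ℝ E2 : ℝ)] A ≤ μH[(Module.finrank ℝ E2 : ℝ)] (T '' A) := by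
    simpa using h1
  gcongr

section body
variable {K : Set E2}

lemma K_diam (hKc : IsCompact K) (hw : ∀ u : E2, ‖u‖ = 1 → dirWidth K u = 1)
    {x y : E2} (hx : x ∈ K) (hy : y ∈ K) : ‖x - y‖ ≤ 1 := by
  by_cases h : x - y = 0
  · simp [h]
  have hn : 0 < ‖x - y‖ := norm_pos_iff.2 h
  have hu : ‖(‖x - y‖⁻¹ : ℝ) • (x - y)‖ = 1 := by
    rw [norm_smul, norm_inv, norm_norm, inv_mul_cancel₀ hn.ne']
  rw [← hw _ hu]
  refine le_csSup ?_ ⟨x, hx, y, hy, ?_⟩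
  · have : {w : ℝ | ∃ a ∈ K, ∃ b ∈ K, w = ⟪a - b, (‖x - y‖⁻¹ : ℝ) • (x - y)⟫_ℝ} =
        (fun p : E2 × E2 => ⟪p.1 - p.2, (‖x - y‖⁻¹ : ℝ) • (x - y)⟫_ℝ) '' (K ×ˢ K) := by
      ext w
      constructor
      · rintro ⟨a, ha, b, hb, rfl⟩
        exact ⟨(a, b), ⟨ha, hb⟩, rfl⟩
      · rintro ⟨⟨a, b⟩, ⟨ha, hb⟩, rfl⟩
        exact ⟨a, ha, b, hb, rfl⟩
    rw [this]
    exact ((hKc.prod hKc).image (by fun_prop)).bddAbove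
  · rw [inner_smul_right, real_inner_self_eq_norm_sq]
    field_simp

lemma unit_eq {a u : E2} (ha : ‖a‖ ≤ 1) (hu : ‖u‖ = 1) (h : 1 ≤ ⟪a, u⟫_ℝ) : a = u := by
  have := norm_sub_sq_real a u
  have h2 : ‖a - u‖ ^ 2 ≤ 0 := by
    rw [this, hu]
    nlinarith [norm_nonneg a]
  have h3 : ‖a - u‖ = 0 := by nlinarith [norm_nonneg (a - u)]
  exact sub_eq_zero.1 (norm_eq_zero.1 h3)

lemma K_att (hKc : IsCompact K) (hne : K.Nonempty)
    (hw : ∀ u : E2, ‖u‖ = 1 → dirWidth K u = 1) (u : E2) (hu : ‖u‖ = 1) :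
    ∃ a ∈ K, ∃ b ∈ K, a - b = u := by
  have h0 := hw u hu
  have : {w : ℝ | ∃ a ∈ K, ∃ b ∈ K, w = ⟪a - b, u⟫_ℝ} =
      (fun p : E2 × E2 => ⟪p.1 - p.2, u⟫_ℝ) '' (K ×ˢ K) := by
    ext w
    constructor
    · rintro ⟨a, ha, b, hb, rfl⟩
      exact ⟨(a, b), ⟨ha, hb⟩, rfl⟩
    · rintro ⟨⟨a, b⟩, ⟨ha, hb⟩, rfl⟩
      exact ⟨a, ha, b, hb, rfl⟩
  have hc : IsCompact ((fun p : E2 × E2 => ⟪p.1 - p.2, u⟫_ℝ) '' (K ×ˢ K)) :=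
    (hKc.prod hKc).image (by fun_prop)
  have hm := hc.sSup_mem ((hne.prod hne).image _)
  rw [← this] at hm
  obtain ⟨a, ha, b, hb, hab⟩ := hm
  refine ⟨a, ha, b, hb, unit_eq (K_diam hKc hw ha hb) hu ?_⟩
  rw [← hab]
  exact h0.ge

lemma K_proj (hKc : IsCompact K) (hKconv : Convex ℝ K) (hne : K.Nonempty)
    (hw : ∀ u : E2, ‖u‖ = 1 → dirWidth K u = 1) (x : E2) (hx : x ∉ K) :
    ∃ y ∈ K, ∃ (u : E2) (a : ℝ), ‖u‖ = 1 ∧ 1 < a ∧ y + u ∈ K ∧ x = y + a • u := by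
  obtain ⟨p, hp, hpn⟩ := exists_norm_eq_iInf_of_complete_convex hne hKc.isComplete hKconv x
  rw [norm_eq_iInf_iff_real_inner_le_zero hKconv hp] at hpn
  have hxp : x - p ≠ 0 := fun h => hx (by rw [sub_eq_zero.1 h]; exact hp)
  have hn : 0 < ‖x - p‖ := norm_pos_iff.2 hxp
  obtain ⟨u, hu⟩ : ∃ u : E2, u = (‖x - p‖⁻¹ : ℝ) • (x - p) := ⟨_, rfl⟩
  have hu1 : ‖u‖ = 1 := by
    rw [hu, norm_smul, norm_inv, norm_norm, inv_mul_cancel₀ hn.ne']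
  have hxu : x - p = ‖x - p‖ • u := by
    rw [hu, smul_smul, mul_inv_cancel₀ hn.ne', one_smul]
  obtain ⟨a, ha, b, hb, hab⟩ := K_att hKc hne hw u hu1
  have h1 : ⟪a - p, u⟫_ℝ ≤ 0 := by
    rw [real_inner_comm, hu, inner_smul_left]
    have := hpn a ha
    simp only [conj_trivial]
    exact mul_nonpos_of_nonneg_of_nonpos (by positivity) this
  have h2 : ⟪a - b, u⟫_ℝ = 1 := by
    rw [hab, real_inner_self_eq_norm_sq, hu1]; norm_num
  have h3 : p - b = u := by
    apply unit_eq (K_diam hKc hw hp hb) hu1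
    have : p - b = (a - b) - (a - p) := by abel
    rw [this, inner_sub_left]
    linarith
  refine ⟨b, hb, u, 1 + ‖x - p‖, hu1, by linarith, ?_, ?_⟩
  · rw [← h3]; simpa using hp
  · rw [add_smul, one_smul, ← hxu, ← h3]; abel

/-- The key expansion property. -/
lemma expand (hd : ∀ x ∈ K, ∀ y ∈ K, ‖x - y‖ ≤ 1) {y₁ y₂ u₁ u₂ : E2} {a b : ℝ}
    (hy₁ : y₁ ∈ K) (hy₂ : y₂ ∈ K) (hu₁ : ‖u₁‖ = 1) (hu₂ : ‖u₂‖ = 1) (ha : 1 < a) (hb : 1 < b)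
    (h₁ : y₁ + u₁ ∈ K) (h₂ : y₂ + u₂ ∈ K) :
    dist (y₁ + a • u₁) (y₂ + b • u₂) ≤ dist (a • u₁) (b • u₂) := by
  rw [dist_eq_norm, dist_eq_norm]
  obtain ⟨d, hd'⟩ : ∃ d, d = y₁ - y₂ := ⟨_, rfl⟩
  have e : y₁ + a • u₁ - (y₂ + b • u₂) = d + (a • u₁ - b • u₂) := by rw [hd']; abel
  have i1 : ‖d + u₁‖ ≤ 1 := by
    have := hd _ h₁ _ hy₂
    rwa [show y₁ + u₁ - y₂ = d + u₁ by rw [hd']; abel] at this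
  have i2 : ‖d - u₂‖ ≤ 1 := by
    have := hd _ hy₁ _ h₂
    rwa [show y₁ - (y₂ + u₂) = d - u₂ by rw [hd']; abel] at this
  have j1 := norm_add_sq_real d u₁
  have j2 := norm_sub_sq_real d u₂
  have k1 : ‖d‖ ^ 2 + 2 * ⟪d, u₁⟫_ℝ ≤ 0 := by
    rw [hu₁] at j1; nlinarith [norm_nonneg (d + u₁)]
  have k2 : ‖d‖ ^ 2 - 2 * ⟪d, u₂⟫_ℝ ≤ 0 := by
    rw [hu₂] at j2; nlinarith [norm_nonneg (d - u₂)]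
  rw [e]
  apply le_of_sq_le_sq _ (norm_nonneg _)
  rw [norm_add_sq_real, inner_sub_right, inner_smul_right, inner_smul_right]
  nlinarith [sq_nonneg ‖d‖]

/-- Support function. -/
def hsup (K : Set E2) (θ : ℝ) : ℝ := sSup ((fun x => ⟪x, uv θ⟫_ℝ) '' K)

lemma K_img (hKc : IsCompact K) (hKconv : Convex ℝ K) (hne : K.Nonempty)
    (hw : ∀ u : E2, ‖u‖ = 1 → dirWidth K u = 1) (θ : ℝ) :
    (fun x => ⟪x, uv θ⟫_ℝ) '' K = Set.Icc (hsup K θ - 1) (hsup K θ) := by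
  have hcont : Continuous (fun x : E2 => ⟪x, uv θ⟫_ℝ) := by fun_prop
  have h := eq_Icc_of_connected_compact
    ⟨hne.image _, hKconv.isPreconnected.image (fun x => ⟪x, uv θ⟫_ℝ) hcont.continuousOn⟩
    (hKc.image hcont)
  have hle : sInf ((fun x => ⟪x, uv θ⟫_ℝ) '' K) ≤ sSup ((fun x => ⟪x, uv θ⟫_ℝ) '' K) := by
    have := hne.image (fun x => ⟪x, uv θ⟫_ℝ)
    rw [h] at this
    exact Set.nonempty_Icc.1 this
  have hi : sInf ((fun x => ⟪x, uv θ⟫_ℝ) '' K) = hsup K θ - 1 := by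
    rw [hsup]
    generalize sInf ((fun x => ⟪x, uv θ⟫_ℝ) '' K) = m at *
    generalize sSup ((fun x => ⟪x, uv θ⟫_ℝ) '' K) = M at *
    apply le_antisymm
    · obtain ⟨a, ha, b, hb, hab⟩ := K_att hKc hne hw (uv θ) (uv_norm θ)
      have h1 : ⟪a, uv θ⟫_ℝ ∈ Set.Icc m M := h ▸ ⟨a, ha, rfl⟩
      have h2 : ⟪b, uv θ⟫_ℝ ∈ Set.Icc m M := h ▸ ⟨b, hb, rfl⟩
      have h3 : ⟪a - b, uv θ⟫_ℝ = 1 := by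
        rw [hab, real_inner_self_eq_norm_sq, uv_norm]; norm_num
      rw [inner_sub_left] at h3
      linarith [h1.2, h2.1]
    · have h1 : m ∈ Set.Icc m M := ⟨le_rfl, hle⟩
      have h2 : M ∈ Set.Icc m M := ⟨hle, le_rfl⟩
      rw [← h] at h1 h2
      obtain ⟨a, ha, ha'⟩ := h1
      obtain ⟨b, hb, hb'⟩ := h2
      have h3 := real_inner_le_norm (b - a) (uv θ)
      rw [uv_norm, inner_sub_left] at h3
      have := K_diam hKc hw hb ha
      simp only at ha' hb'
      linarith
  rw [hi] at h
  exact h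

lemma uv_add_pi (θ : ℝ) : uv (θ + π) = - uv θ := by
  ext i
  fin_cases i <;> simp

lemma hsup_pi (hKc : IsCompact K) (hKconv : Convex ℝ K) (hne : K.Nonempty)
    (hw : ∀ u : E2, ‖u‖ = 1 → dirWidth K u = 1) (θ : ℝ) : hsup K (θ + π) = 1 - hsup K θ := by
  have h1 := K_img hKc hKconv hne hw θ
  rw [hsup]
  have : (fun x => ⟪x, uv (θ + π)⟫_ℝ) '' K = -((fun x => ⟪x, uv θ⟫_ℝ) '' K) := by
    rw [← Set.image_neg_eq_neg, Set.image_image]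
    simp [uv_add_pi]
  rw [this, h1, Set.neg_Icc, csSup_Icc (by linarith)]
  ring

lemma hsup_cont (hKc : IsCompact K) : Continuous (hsup K) := by
  apply hKc.continuous_sSup
  have : (Function.HasUncurry.uncurry fun (θ : ℝ) (x : E2) => ⟪x, uv θ⟫_ℝ) =
      fun p : ℝ × E2 => p.2 0 * cos p.1 + p.2 1 * sin p.1 := by
    ext p
    exact uv_inner _ _
  rw [this]
  fun_prop

/-- A constant width body is contained in a regular hexagon of width one. -/
lemma exists_hex (hKc : IsCompact K) (hKconv : Convex ℝ K) (hne : K.Nonempty)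
    (hw : ∀ u : E2, ‖u‖ = 1 → dirWidth K u = 1) :
    ∃ (c : E2) (θ : ℝ), K ⊆ hexSum {c} θ := by
  obtain ⟨F, hF⟩ : ∃ F : ℝ → ℝ, F = fun θ => (hsup K θ - 1 / 2) - (hsup K (θ + π / 3) - 1 / 2)
    + (hsup K (θ + 2 * π / 3) - 1 / 2) := ⟨_, rfl⟩
  have hcont : Continuous F := by
    have := hsup_cont hKc
    rw [hF]; fun_prop
  have hanti : F (0 + π / 3) = - F 0 := by
    have := hsup_pi hKc hKconv hne hw 0
    rw [hF]
    simp only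
    rw [show 0 + π / 3 + 2 * π / 3 = 0 + π by ring, this,
      show (0 : ℝ) + π / 3 + π / 3 = 0 + 2 * π / 3 by ring]
    ring
  obtain ⟨θ, hθ⟩ : ∃ θ, F θ = 0 := by
    rcases le_total (F 0) 0 with h | h
    · exact mem_range_of_exists_le_of_exists_ge hcont ⟨0, h⟩ ⟨0 + π / 3, by linarith⟩
    · exact mem_range_of_exists_le_of_exists_ge hcont ⟨0 + π / 3, by linarith⟩ ⟨0, h⟩
  rw [hF] at hθ
  simp only at hθ
  have s3 : √3 * √3 = 3 := Real.mul_self_sqrt (by norm_num)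
  have cs := sin_sq_add_cos_sq θ
  obtain ⟨s, hs⟩ : ∃ s, s = hsup K θ - 1 / 2 := ⟨_, rfl⟩
  obtain ⟨t, ht⟩ : ∃ t, t = hsup K (θ + 2 * π / 3) - 1 / 2 := ⟨_, rfl⟩
  obtain ⟨n, hn⟩ : ∃ n, n = √3 / 3 * (2 * t + s) := ⟨_, rfl⟩
  refine ⟨pt (s * cos θ - n * sin θ) (s * sin θ + n * cos θ), θ, fun x hx => ?_⟩
  have hc0 : ⟪pt (s * cos θ - n * sin θ) (s * sin θ + n * cos θ), uv θ⟫_ℝ = s := by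
    rw [uv_inner]; simp [pt]
    linear_combination s * cs
  have hc2 : ⟪pt (s * cos θ - n * sin θ) (s * sin θ + n * cos θ), uv (θ + 2 * π / 3)⟫_ℝ = t := by
    rw [uv_inner]
    simp only [cos_add, sin_add, sin_two_pi_div_three', cos_two_pi_div_three']
    simp [pt]
    linear_combination (-s / 2 + √3 / 2 * n) * cs + √3 / 2 * hn + (2 * t + s) / 6 * s3
  have hc1 : ⟪pt (s * cos θ - n * sin θ) (s * sin θ + n * cos θ), uv (θ + π / 3)⟫_ℝ = s + t := by
    refine Eq.trans ?_ (congrArg₂ (· + ·) hc0 hc2)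
    simp only [uv_inner, cos_add, sin_add, cos_pi_div_three, sin_pi_div_three,
      sin_two_pi_div_three', cos_two_pi_div_three']
    ring
  have hb : ∀ φ, ⟪x, uv φ⟫_ℝ ∈ Set.Icc (hsup K φ - 1) (hsup K φ) := fun φ => by
    rw [← K_img hKc hKconv hne hw φ]; exact ⟨x, hx, rfl⟩
  have b0 := hb θ
  have b1 := hb (θ + π / 3)
  have b2 := hb (θ + 2 * π / 3)
  rw [Set.mem_Icc] at b0 b1 b2
  apply mem_hex
  · rw [inner_sub_left, hc0, abs_le]; constructor <;> linarith
  · rw [inner_sub_left, hc1, abs_le]; constructor <;> linarith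
  · rw [inner_sub_left, hc2, abs_le]; constructor <;> linarith

end body

lemma HasW.single (c : E2) (θ : ℝ) : HasW {c} θ 0 := ⟨⟪c, uv θ⟫_ℝ, by simp⟩

/-- The Blaschke–Lebesgue theorem: every convex body of constant width 1 in the
Euclidean plane has area at least `(π - √3)/2`. -/
theorem blaschke_lebesgue (K : Set E2) (hKc : IsCompact K) (hKconv : Convex ℝ K)
    (hKint : (interior K).Nonempty)
    (hw : ∀ u : E2, ‖u‖ = 1 → dirWidth K u = 1) :
    ENNReal.ofReal ((π - Real.sqrt 3) / 2) ≤ volume K := by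
  have hne : K.Nonempty := hKint.mono interior_subset
  obtain ⟨c, θ, hH⟩ := exists_hex hKc hKconv hne hw
  have hd : ∀ x ∈ K, ∀ y ∈ K, ‖x - y‖ ≤ 1 := fun x hx y hy => K_diam hKc hw hx hy
  -- areas
  have hwN : ∀ φ, HasW (-K) φ 1 := fun φ => by
    refine ⟨- hsup K φ, ?_⟩
    have : (fun x => ⟪x, uv φ⟫_ℝ) '' (-K) = -((fun x => ⟪x, uv φ⟫_ℝ) '' K) := by
      rw [← Set.image_neg_eq_neg, ← Set.image_neg_eq_neg, Set.image_image, Set.image_image]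
      simp
    rw [this, K_img hKc hKconv hne hw φ, Set.neg_Icc]
    congr 1
    ring
  have hwC : ∀ φ, HasW ({c} + -K) φ 1 := fun φ => by
    simpa using (HasW.single c φ).add le_rfl zero_le_one (hwN φ)
  have vH : volume (hexSum {c} θ) = ENNReal.ofReal (√3 / 2) := by
    rw [vol_hex {c} isCompact_singleton (convex_singleton c) θ 0 le_rfl (HasW.single _ _)
      (HasW.single _ _) (HasW.single _ _)]
    simp
  have vHK : volume (hexSum {c} θ + -K) = volume K + ENNReal.ofReal (√3 * 1 + √3 / 2) := by
    have e : hexSum {c} θ + -K = hexSum ({c} + -K) θ := by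
      unfold hexSum
      simp only [add_assoc, add_comm, add_left_comm]
    rw [e, vol_hex _ (isCompact_singleton.add hKc.neg) ((convex_singleton c).add hKconv.neg) θ 1
      zero_le_one (hwC _) (hwC _) (hwC _)]
    congr 1
    rw [Set.singleton_add, Set.image_add_left, measure_preimage_add, Measure.measure_neg]
  -- the expanding map
  choose! Y hY U a hU ha hYU hx using K_proj hKc hKconv hne hw
  obtain ⟨T, hT⟩ : ∃ T : E2 → E2, T = fun x => a x • U x := ⟨_, rfl⟩
  have hexp : volume (hexSum {c} θ \ K) ≤ volume (T '' (hexSum {c} θ \ K)) := by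
    apply lip_vol
    intro x hx1 y hy1
    have := expand hd (hY x hx1.2) (hY y hy1.2) (hU x hx1.2) (hU y hy1.2) (ha x hx1.2)
      (ha y hy1.2) (hYU x hx1.2) (hYU y hy1.2)
    rw [← hx x hx1.2, ← hx y hy1.2] at this
    rw [hT]
    exact this
  have hsub1 : T '' (hexSum {c} θ \ K) ⊆ hexSum {c} θ + -K := by
    rintro _ ⟨x, hx1, rfl⟩
    refine ⟨x, hx1.1, - Y x, Set.neg_mem_neg.2 (hY x hx1.2), ?_⟩
    rw [hT]
    simp only
    nth_rewrite 1 [hx x hx1.2]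
    abel
  have hball : closedBall (0 : E2) 1 ⊆ hexSum {c} θ + -K := by
    have hcv : Convex ℝ (K + -K) := hKconv.add hKconv.neg
    have h0 : (0 : E2) ∈ K + -K := by
      obtain ⟨k, hk⟩ := hne
      exact ⟨k, hk, -k, Set.neg_mem_neg.2 hk, by simp⟩
    refine subset_trans ?_ (Set.add_subset_add_right hH)
    intro z hz
    rw [mem_closedBall_zero_iff] at hz
    by_cases hz0 : z = 0
    · rw [hz0]; exact h0
    have hn : 0 < ‖z‖ := norm_pos_iff.2 hz0
    obtain ⟨p, hp, q, hq, hpq⟩ := K_att hKc hne hw ((‖z‖⁻¹ : ℝ) • z)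
      (by rw [norm_smul, norm_inv, norm_norm, inv_mul_cancel₀ hn.ne'])
    have hm : (‖z‖⁻¹ : ℝ) • z ∈ K + -K :=
      ⟨p, hp, -q, Set.neg_mem_neg.2 hq, by rw [← hpq]; simp [sub_eq_add_neg]⟩
    have := hcv.smul_mem_of_zero_mem h0 hm ⟨hn.le, hz⟩
    rwa [smul_smul, mul_inv_cancel₀ hn.ne', one_smul] at this
  have hdisj : Disjoint (closedBall (0 : E2) 1) (T '' (hexSum {c} θ \ K)) := by
    rw [Set.disjoint_left]
    rintro _ hz ⟨x, hx1, rfl⟩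
    have h1 := ha x hx1.2
    rw [mem_closedBall_zero_iff, hT] at hz
    simp only [norm_smul, hU x hx1.2, Real.norm_eq_abs, mul_one] at hz
    linarith [le_abs_self (a x)]
  have hB : volume (closedBall (0 : E2) 1) = ENNReal.ofReal π := by
    rw [EuclideanSpace.volume_closedBall_fin_two]
    simp [ENNReal.ofReal, Real.toNNReal_of_nonneg pi_pos.le]
  have hfin : volume K ≠ ⊤ := hKc.measure_ne_top
  have h1 : ENNReal.ofReal π + volume (hexSum {c} θ \ K) ≤ volume (hexSum {c} θ + -K) := by
    calc _ ≤ volume (closedBall (0 : E2) 1) + volume (T '' (hexSum {c} θ \ K)) := by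
          rw [hB]; gcongr
      _ = volume (closedBall (0 : E2) 1 ∪ T '' (hexSum {c} θ \ K)) :=
          (measure_union' hdisj measurableSet_closedBall).symm
      _ ≤ _ := measure_mono (Set.union_subset hball hsub1)
  have h2 : volume (hexSum {c} θ) ≤ volume (hexSum {c} θ \ K) + volume K := by
    refine (measure_mono ?_).trans (measure_union_le _ _)
    intro x hx
    by_cases h : x ∈ K
    · exact Or.inr h
    · exact Or.inl ⟨hx, h⟩
  have h3 : ENNReal.ofReal π + ENNReal.ofReal (√3 / 2) ≤
      volume K + ENNReal.ofReal (√3 * 1 + √3 / 2) + volume K := by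
    rw [← vH, ← vHK]
    calc _ ≤ ENNReal.ofReal π + (volume (hexSum {c} θ \ K) + volume K) := by gcongr
      _ = (ENNReal.ofReal π + volume (hexSum {c} θ \ K)) + volume K := by rw [add_assoc]
      _ ≤ _ := by gcongr
  obtain ⟨v, hv, hv0⟩ : ∃ v : ℝ, volume K = ENNReal.ofReal v ∧ 0 ≤ v :=
    ⟨(volume K).toReal, (ENNReal.ofReal_toReal hfin).symm, ENNReal.toReal_nonneg⟩
  rw [hv] at h3 ⊢
  have s0 : 0 ≤ √3 := Real.sqrt_nonneg 3
  rw [← ENNReal.ofReal_add (by positivity) (by positivity), ← ENNReal.ofReal_add hv0 (by positivity),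
    ← ENNReal.ofReal_add (by positivity) hv0, ENNReal.ofReal_le_ofReal_iff (by positivity)] at h3
  apply ENNReal.ofReal_le_ofReal
  linarith
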